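/- arXiv:2501.04491 — 6 statements merged into one kernel-verified Lean document; each statement's English description precedes it below -/
import Mathlib

section
/- (Lower bound theory, case 1 ≤ p ≤ 2.) Suppose ψ satisfies Assumption 1, 1 ≤ p ≤ 2, α > 0, A is a nonzero matrix, and x* ∈ ℝ^n is a local minimizer of E. Then for every group g_i with x*_{g_i} ≠ 0 one has ψ''(‖x*_{g_i}‖_p) ≥ −‖A‖₂²/α; in particular, since ψ'' is nondecreasing, ‖x*_{g_i}‖_p ≥ κ for every κ > 0 with α·ψ''(κ) + ‖A‖₂² < 0, so the p-norms of the nonzero groups of any local minimizer are uniformly bounded below by the positive constant κ = (ψ'')^{-1}(−‖A‖₂²/α). -/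
/-- Second-order necessary condition for a local minimum on the real line. -/
theorem IsLocalMin.second_deriv_nonneg {f f' : ℝ → ℝ} {a c : ℝ} (h : IsLocalMin f a)
    (hf : ∀ᶠ x in nhds a, HasDerivAt f (f' x) x) (hf' : HasDerivAt f' c a) : 0 ≤ c := by
  by_contra! hc
  have hderiv : deriv f =ᶠ[nhds a] f' := hf.mono fun x hx => hx.deriv
  have hdd : deriv (deriv f) a = c := by rw [hderiv.deriv_eq, hf'.deriv]
  have hmax : IsLocalMax f a :=
    isLocalMax_of_deriv_deriv_neg (hdd ▸ hc) h.deriv_eq_zero hf.self_of_nhds.continuousAt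
  have hconst : f =ᶠ[nhds a] fun _ => f a := by
    filter_upwards [h, hmax] with x h₁ h₂ using le_antisymm h₂ h₁
  have hzero : deriv (deriv f) a = 0 := by
    rw [hconst.deriv.deriv_eq]
    simp
  exact hc.ne (hdd.symm.trans hzero)

/-- The `ℓ²` norm is at most the `ℓᵖ` norm for `0 < p ≤ 2`. -/
theorem sum_sq_le_Lp_sq {ι : Type*} (s : Finset ι) (x : ι → ℝ) {p : ℝ} (hp0 : 0 < p)
    (hp2 : p ≤ 2) :
    ∑ j ∈ s, x j ^ 2 ≤ ((∑ j ∈ s, |x j| ^ p) ^ (1 / p)) ^ 2 := by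
  have hterm : ∀ j, 0 ≤ |x j| ^ p := fun j => by positivity
  set S := ∑ j ∈ s, |x j| ^ p with hS
  have hS0 : 0 ≤ S := Finset.sum_nonneg fun j _ => hterm j
  have hsq : ∀ y : ℝ, 0 ≤ y → y ^ 2 = (y ^ p) * (y ^ p) ^ (2 / p - 1) := by
    intro y hy
    have hpow : y ^ 2 = (y ^ p) ^ (1 + (2 / p - 1)) := by
      rw [← Real.rpow_mul hy, ← Real.rpow_natCast]
      congr 1
      push_cast
      field_simp
      ring
    have hexp : 0 ≤ 2 / p - 1 := by rw [sub_nonneg, le_div_iff₀ hp0]; linarith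
    rw [hpow, Real.rpow_add_of_nonneg (by positivity) zero_le_one hexp, Real.rpow_one]
  have hroot : (S ^ (1 / p)) ^ p = S := by
    rw [← Real.rpow_mul hS0, one_div_mul_cancel hp0.ne', Real.rpow_one]
  rw [hsq _ (by positivity), hroot, hS, Finset.sum_mul, ← hS]
  refine Finset.sum_le_sum fun j hj => ?_
  rw [← sq_abs, hsq _ (abs_nonneg _)]
  have hle : |x j| ^ p ≤ S := Finset.single_le_sum (fun k _ => hterm k) hj
  have hexp : 0 ≤ 2 / p - 1 := by rw [sub_nonneg, le_div_iff₀ hp0]; linarith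
  gcongr

/-- The `ℓᵖ` norm is positively homogeneous. -/
theorem Lp_mul {ι : Type*} (s : Finset ι) (x : ι → ℝ) {p t : ℝ} (hp0 : 0 < p) (ht : 0 ≤ t) :
    (∑ j ∈ s, |t * x j| ^ p) ^ (1 / p) = t * (∑ j ∈ s, |x j| ^ p) ^ (1 / p) := by
  have hS0 : 0 ≤ ∑ j ∈ s, |x j| ^ p := Finset.sum_nonneg fun j _ => by positivity
  simp_rw [abs_mul, abs_of_nonneg ht, Real.mul_rpow ht (abs_nonneg _), ← Finset.mul_sum]
  rw [Real.mul_rpow (by positivity) hS0, ← Real.rpow_mul ht, mul_one_div_cancel hp0.ne',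
    Real.rpow_one]


/-- Lower bound theory, case `1 ≤ p ≤ 2`.  Under Assumption 1 on `ψ` (concave,
coercive, `C²` on `(0,∞)`, `ψ(0)=0`, `ψ'(0+)=+∞`, `ψ''` nondecreasing), `α > 0`,
`A ≠ 0` with spectral norm bound `N` (`‖Ax‖₂ ≤ N‖x‖₂`), if `x*` is a local
minimizer of `E` then every nonzero group of `x*` satisfies
`ψ''(‖x*_{gᵢ}‖_p) ≥ -N²/α`; in particular, since `ψ''` is nondecreasing,
`‖x*_{gᵢ}‖_p ≥ κ` for every `κ > 0` with `α·ψ''(κ) + N² < 0`. -/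
theorem stmt_5 (m n r : ℕ) (hm : 1 ≤ m) (hn : 1 ≤ n) (hr : 1 ≤ r)
    (g : Fin r → Finset (Fin n))
    (hne : ∀ i, (g i).Nonempty)
    (hdisj : ∀ i i', i ≠ i' → Disjoint (g i) (g i'))
    (hcover : ∀ j, ∃ i, j ∈ g i)
    (A : Matrix (Fin m) (Fin n) ℝ) (hA : A ≠ 0) (b : Fin m → ℝ)
    (α p : ℝ) (hα : 0 < α) (hp1 : 1 ≤ p) (hp2 : p ≤ 2)
    (ψ ψ' ψ'' : ℝ → ℝ)
    (hψnn : ∀ t ∈ Set.Ici (0:ℝ), 0 ≤ ψ t)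
    (hconc : ConcaveOn ℝ (Set.Ici 0) ψ)
    (hcoer : Filter.Tendsto ψ Filter.atTop Filter.atTop)
    (hd1 : ∀ t ∈ Set.Ioi (0:ℝ), HasDerivAt ψ (ψ' t) t)
    (hd2 : ∀ t ∈ Set.Ioi (0:ℝ), HasDerivAt ψ' (ψ'' t) t)
    (hd2cont : ContinuousOn ψ'' (Set.Ioi 0))
    (hψ0 : ψ 0 = 0)
    (hblow : Filter.Tendsto ψ' (nhdsWithin 0 (Set.Ioi 0)) Filter.atTop)
    (hmono : MonotoneOn ψ'' (Set.Ioi 0))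
    (N : ℝ)
    (hN : ∀ x : Fin n → ℝ,
      Real.sqrt (∑ k, (A.mulVec x k) ^ 2) ≤ N * Real.sqrt (∑ j, (x j) ^ 2))
    (E : (Fin n → ℝ) → ℝ)
    (hE : ∀ x, E x = 1 / 2 * (∑ k, (A.mulVec x k - b k) ^ 2)
        + α * (∑ i, ψ ((∑ j ∈ g i, |x j| ^ p) ^ (1 / p))))
    (xstar : Fin n → ℝ) (hmin : IsLocalMin E xstar) :
    ∀ i : Fin r, (∃ j ∈ g i, xstar j ≠ 0) →
      (-(N ^ 2) / α ≤ ψ'' ((∑ j ∈ g i, |xstar j| ^ p) ^ (1 / p)) ∧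
       ∀ κ : ℝ, 0 < κ → α * ψ'' κ + N ^ 2 < 0 →
         κ ≤ (∑ j ∈ g i, |xstar j| ^ p) ^ (1 / p)) := by
  have hp0 : 0 < p := by linarith
  rintro i ⟨j₀, hj₀, hx₀⟩
  set ρ := (∑ j ∈ g i, |xstar j| ^ p) ^ (1 / p) with hρ
  have hρ0 : 0 < ρ := by
    refine Real.rpow_pos_of_pos ?_ _
    exact Finset.sum_pos' (fun j _ => by positivity)
      ⟨j₀, hj₀, Real.rpow_pos_of_pos (abs_pos.mpr hx₀) _⟩
  set v : Fin n → ℝ := fun j => if j ∈ g i then xstar j else 0 with hv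
  have hAv : ∑ k, (A.mulVec v k) ^ 2 ≤ N ^ 2 * ρ ^ 2 := by
    have hsq : ∑ k, (A.mulVec v k) ^ 2 ≤ N ^ 2 * ∑ j, v j ^ 2 := by
      have h := pow_le_pow_left₀ (Real.sqrt_nonneg _) (hN v) 2
      rwa [mul_pow, Real.sq_sqrt (Finset.sum_nonneg fun _ _ => sq_nonneg _),
        Real.sq_sqrt (Finset.sum_nonneg fun _ _ => sq_nonneg _)] at h
    have hvsum : ∑ j, v j ^ 2 = ∑ j ∈ g i, xstar j ^ 2 := by
      simp [hv, ite_pow, Finset.sum_ite_mem]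
    refine hsq.trans ?_
    rw [hvsum]
    exact mul_le_mul_of_nonneg_left (sum_sq_le_Lp_sq _ _ hp0 hp2) (sq_nonneg N)
  have hline : IsLocalMin (fun s : ℝ => E (xstar + s • v)) 0 := by
    have hc : ContinuousAt (fun s : ℝ => xstar + s • v) 0 := by fun_prop
    have hmin' : IsLocalMin E (xstar + (0 : ℝ) • v) := by simpa using hmin
    exact hc.eventually hmin'
  set C := ∑ i' ∈ Finset.univ.erase i, ψ ((∑ j ∈ g i', |xstar j| ^ p) ^ (1 / p)) with hC
  have hEline : ∀ᶠ s : ℝ in nhds 0, E (xstar + s • v) =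
      1 / 2 * (∑ k, (A.mulVec xstar k - b k + s * A.mulVec v k) ^ 2)
        + α * (ψ ((1 + s) * ρ) + C) := by
    filter_upwards [lt_mem_nhds (show (-1 : ℝ) < 0 by norm_num)] with s hs
    rw [hE, ← Finset.add_sum_erase _ _ (Finset.mem_univ i)]
    congr 3
    · funext k
      rw [Matrix.mulVec_add, Matrix.mulVec_smul]
      simp only [Pi.add_apply, Pi.smul_apply, smul_eq_mul]
      ring
    · congr 1
      rw [hρ, ← Lp_mul _ _ hp0 (by linarith)]
      congr 1
      refine Finset.sum_congr rfl fun j hj => ?_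
      simp [hv, hj, add_mul]
    · refine Finset.sum_congr rfl fun i' hi' => ?_
      congr 2
      refine Finset.sum_congr rfl fun j hj => ?_
      have hj' : j ∉ g i :=
        Finset.disjoint_left.mp (hdisj i' i (Finset.ne_of_mem_erase hi')) hj
      simp [hv, hj']
  have hlocal := hline.congr hEline
  have hd : ∀ᶠ s : ℝ in nhds 0, HasDerivAt
      (fun s : ℝ => 1 / 2 * (∑ k, (A.mulVec xstar k - b k + s * A.mulVec v k) ^ 2)
        + α * (ψ ((1 + s) * ρ) + C))
      ((∑ k, (A.mulVec xstar k - b k + s * A.mulVec v k) * A.mulVec v k)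
        + α * (ψ' ((1 + s) * ρ) * ρ)) s := by
    filter_upwards [lt_mem_nhds (show (-1 : ℝ) < 0 by norm_num)] with s hs
    have harg : HasDerivAt (fun s : ℝ => (1 + s) * ρ) ρ s := by
      simpa using ((hasDerivAt_id s).const_add 1).mul_const ρ
    have hψs : HasDerivAt (fun s : ℝ => ψ ((1 + s) * ρ)) (ψ' ((1 + s) * ρ) * ρ) s :=
      (hd1 _ (mul_pos (by linarith) hρ0)).comp s harg
    have hq : HasDerivAt
        (fun s : ℝ => ∑ k, (A.mulVec xstar k - b k + s * A.mulVec v k) ^ 2)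
        (∑ k, 2 * (A.mulVec xstar k - b k + s * A.mulVec v k) * A.mulVec v k) s := by
      refine HasDerivAt.fun_sum fun k _ => ?_
      simpa using (((hasDerivAt_id s).mul_const (A.mulVec v k)).const_add
        (A.mulVec xstar k - b k)).fun_pow 2
    refine ((hq.const_mul (1 / 2)).fun_add ((hψs.add_const C).const_mul α)).congr_deriv ?_
    simp_rw [mul_assoc, ← Finset.mul_sum]
    ring
  have hdd : HasDerivAt
      (fun s : ℝ => (∑ k, (A.mulVec xstar k - b k + s * A.mulVec v k) * A.mulVec v k)
        + α * (ψ' ((1 + s) * ρ) * ρ))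
      ((∑ k, A.mulVec v k ^ 2) + α * (ψ'' ρ * ρ * ρ)) 0 := by
    have harg : HasDerivAt (fun s : ℝ => (1 + s) * ρ) ρ 0 := by
      simpa using ((hasDerivAt_id (0 : ℝ)).const_add 1).mul_const ρ
    have hψs : HasDerivAt (fun s : ℝ => ψ' ((1 + s) * ρ)) (ψ'' ρ * ρ) 0 :=
      HasDerivAt.comp (0 : ℝ) (by simpa using hd2 ρ hρ0) harg
    refine (HasDerivAt.fun_sum fun k _ => ?_).add ((hψs.mul_const ρ).const_mul α)
    simpa [sq] using (((hasDerivAt_id (0 : ℝ)).mul_const (A.mulVec v k)).const_add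
      (A.mulVec xstar k - b k)).mul_const (A.mulVec v k)
  have hnonneg := hlocal.second_deriv_nonneg hd hdd
  have hkey : 0 ≤ N ^ 2 + α * ψ'' ρ := by
    have hprod : 0 ≤ (N ^ 2 + α * ψ'' ρ) * ρ ^ 2 := by linarith
    exact nonneg_of_mul_nonneg_left hprod (by positivity)
  refine ⟨?_, fun κ hκ hκN => ?_⟩
  · rw [div_le_iff₀ hα]
    linarith
  · by_contra! hlt
    have hle := mul_le_mul_of_nonneg_left (hmono hρ0 hκ hlt.le) hα.le
    linarith
end

section
/- (Group support inclusion.) Suppose ψ satisfies Assumption 1, 1 ≤ p ≤ 2, α > 0, A is a nonzero matrix, and κ > 0 satisfies α·ψ''(κ) + ‖A‖₂² < 0. Let x* ∈ ℝ^n be a local minimizer of E and let y ∈ ℝ^n satisfy ‖x* − y‖_p < κ. Then for every group g_i with y_{g_i} = 0 one has x*_{g_i} = 0; consequently the group support S(x*) = {i : x*_{g_i} ≠ 0} is contained in S(y) = {i : y_{g_i} ≠ 0}. -/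
theorem not_isLocalMin_of_deriv_deriv_neg {f f' : ℝ → ℝ} {x c : ℝ}
    (hf : ∀ᶠ s in nhds x, HasDerivAt f (f' s) s) (hf' : HasDerivAt f' c x) (hc : c < 0) :
    ¬ IsLocalMin f x := by
  intro hmin
  have hderiv : deriv f =ᶠ[nhds x] f' := hf.mono fun s hs => hs.deriv
  have hderiv2 : deriv (deriv f) x = c := by rw [hderiv.deriv_eq, hf'.deriv]
  have hmax : IsLocalMax f x :=
    isLocalMax_of_deriv_deriv_neg (by rwa [hderiv2]) hmin.deriv_eq_zero
      hf.self_of_nhds.continuousAt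
  have hconst : f =ᶠ[nhds x] fun _ => f x := by
    filter_upwards [hmin, hmax] with s h1 h2 using le_antisymm h2 h1
  have hzero : deriv (deriv f) x = 0 := by
    rw [hconst.deriv.deriv_eq]
    simp
  linarith

theorem abs_le_lp_norm {ι : Type*} (s : Finset ι) (d : ι → ℝ) {p : ℝ} (hp : 0 < p)
    {j : ι} (hj : j ∈ s) : |d j| ≤ (∑ j ∈ s, |d j| ^ p) ^ (1 / p) := by
  have h : |d j| ^ p ≤ ∑ j ∈ s, |d j| ^ p :=
    Finset.single_le_sum (f := fun j => |d j| ^ p)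
      (fun _ _ => Real.rpow_nonneg (abs_nonneg _) _) hj
  calc |d j| = (|d j| ^ p) ^ (1 / p) := by
        rw [one_div, Real.rpow_rpow_inv (abs_nonneg _) hp.ne']
    _ ≤ _ := Real.rpow_le_rpow (Real.rpow_nonneg (abs_nonneg _) _) h (by positivity)

theorem sum_sq_le_lp_norm_sq {ι : Type*} (s : Finset ι) (d : ι → ℝ) {p : ℝ} (hp : 0 < p)
    (hp2 : p ≤ 2) : ∑ j ∈ s, d j ^ 2 ≤ ((∑ j ∈ s, |d j| ^ p) ^ (1 / p)) ^ 2 := by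
  have hS : 0 ≤ ∑ j ∈ s, |d j| ^ p :=
    Finset.sum_nonneg fun _ _ => Real.rpow_nonneg (abs_nonneg _) _
  set t := (∑ j ∈ s, |d j| ^ p) ^ (1 / p) with ht
  have ht0 : 0 ≤ t := Real.rpow_nonneg hS _
  have htp : t ^ p = ∑ j ∈ s, |d j| ^ p := by
    rw [ht, one_div, Real.rpow_inv_rpow hS hp.ne']
  have hsplit : ∀ a : ℝ, 0 ≤ a → a ^ 2 = a ^ p * a ^ (2 - p) := fun a ha => by
    rw [← Real.rpow_add_of_nonneg ha hp.le (by linarith), add_sub_cancel, Real.rpow_two]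
  rw [hsplit t ht0, htp, Finset.sum_mul]
  refine Finset.sum_le_sum fun j hj => ?_
  rw [← sq_abs, hsplit _ (abs_nonneg _)]
  exact mul_le_mul_of_nonneg_left
    (Real.rpow_le_rpow (abs_nonneg _) (abs_le_lp_norm s d hp hj) (by linarith))
    (Real.rpow_nonneg (abs_nonneg _) _)

theorem lp_norm_smul {ι : Type*} (s : Finset ι) (d : ι → ℝ) {p : ℝ} (hp : 0 < p) {c : ℝ}
    (hc : 0 ≤ c) : (∑ j ∈ s, |c * d j| ^ p) ^ (1 / p) = c * (∑ j ∈ s, |d j| ^ p) ^ (1 / p) := by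
  have h : ∀ j, |c * d j| ^ p = c ^ p * |d j| ^ p := fun j => by
    rw [abs_mul, abs_of_nonneg hc, Real.mul_rpow hc (abs_nonneg _)]
  simp_rw [h]
  rw [← Finset.mul_sum, Real.mul_rpow (Real.rpow_nonneg hc _)
    (Finset.sum_nonneg fun _ _ => Real.rpow_nonneg (abs_nonneg _) _), one_div,
    Real.rpow_rpow_inv hc hp.ne']

theorem not_isLocalMin_quadratic_add_comp {ι : Type*} [Fintype ι] (u v : ι → ℝ)
    {ψ ψ' : ℝ → ℝ} {α t c C : ℝ} (ht : 0 < t)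
    (hd1 : ∀ t ∈ Set.Ioi (0 : ℝ), HasDerivAt ψ (ψ' t) t) (hd2 : HasDerivAt ψ' c t)
    (hneg : ∑ k, v k ^ 2 + α * (c * t ^ 2) < 0) :
    ¬ IsLocalMin (fun s : ℝ =>
      1 / 2 * (∑ k, (u k + s * v k) ^ 2) + α * (ψ ((1 + s) * t) + C)) 0 := by
  have hlin : ∀ s : ℝ, HasDerivAt (fun s : ℝ => (1 + s) * t) t s := fun s => by
    simpa using ((hasDerivAt_id s).const_add 1).mul_const t
  have hlink : ∀ k, ∀ s : ℝ, HasDerivAt (fun s : ℝ => u k + s * v k) (v k) s := fun k s => by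
    simpa using ((hasDerivAt_id s).mul_const (v k)).const_add (u k)
  refine not_isLocalMin_of_deriv_deriv_neg
    (f' := fun s => ∑ k, (u k + s * v k) * v k + α * (ψ' ((1 + s) * t) * t)) ?_ ?_ hneg
  · filter_upwards [lt_mem_nhds (show (-1 : ℝ) < 0 by norm_num)] with s hs
    have hpos : 0 < (1 + s) * t := mul_pos (by linarith) ht
    have h1 := (HasDerivAt.fun_sum (u := Finset.univ)
      fun k _ => (hlink k s).fun_pow 2).const_mul (1 / 2 : ℝ)
    have h2 := (((hd1 _ hpos).comp s (hlin s)).add_const C).const_mul α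
    refine (h1.add h2).congr_deriv ?_
    congr 1
    rw [Finset.mul_sum]
    refine Finset.sum_congr rfl fun k _ => ?_
    push_cast
    ring
  · have h1 := HasDerivAt.fun_sum (u := Finset.univ)
      fun k _ => (hlink k 0).mul_const (v k)
    have hd2' : HasDerivAt ψ' c ((1 + 0) * t) := by simpa using hd2
    have h2 := ((hd2'.comp (0 : ℝ) (hlin 0)).mul_const t).const_mul α
    refine (h1.add h2).congr_deriv ?_
    simp only [pow_two]
    ring


/-- Group support inclusion.  Under Assumption 1 on `ψ`, `1 ≤ p ≤ 2`, `α > 0`,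
`A ≠ 0` with spectral norm bound `N`, and `κ > 0` with `α·ψ''(κ) + N² < 0`:
if `x*` is a local minimizer of `E` and `y` satisfies `‖x* - y‖_p < κ`, then
every group on which `y` vanishes is a group on which `x*` vanishes; hence
`S(x*) ⊆ S(y)`. -/
theorem stmt_7 (m n r : ℕ) (hm : 1 ≤ m) (hn : 1 ≤ n) (hr : 1 ≤ r)
    (g : Fin r → Finset (Fin n))
    (hne : ∀ i, (g i).Nonempty)
    (hdisj : ∀ i i', i ≠ i' → Disjoint (g i) (g i'))
    (hcover : ∀ j, ∃ i, j ∈ g i)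
    (A : Matrix (Fin m) (Fin n) ℝ) (hA : A ≠ 0) (b : Fin m → ℝ)
    (α p : ℝ) (hα : 0 < α) (hp1 : 1 ≤ p) (hp2 : p ≤ 2)
    (ψ ψ' ψ'' : ℝ → ℝ)
    (hψnn : ∀ t ∈ Set.Ici (0:ℝ), 0 ≤ ψ t)
    (hconc : ConcaveOn ℝ (Set.Ici 0) ψ)
    (hcoer : Filter.Tendsto ψ Filter.atTop Filter.atTop)
    (hd1 : ∀ t ∈ Set.Ioi (0:ℝ), HasDerivAt ψ (ψ' t) t)
    (hd2 : ∀ t ∈ Set.Ioi (0:ℝ), HasDerivAt ψ' (ψ'' t) t)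
    (hd2cont : ContinuousOn ψ'' (Set.Ioi 0))
    (hψ0 : ψ 0 = 0)
    (hblow : Filter.Tendsto ψ' (nhdsWithin 0 (Set.Ioi 0)) Filter.atTop)
    (hmono : MonotoneOn ψ'' (Set.Ioi 0))
    (N : ℝ)
    (hN : ∀ x : Fin n → ℝ,
      Real.sqrt (∑ k, (A.mulVec x k) ^ 2) ≤ N * Real.sqrt (∑ j, (x j) ^ 2))
    (E : (Fin n → ℝ) → ℝ)
    (hE : ∀ x, E x = 1 / 2 * (∑ k, (A.mulVec x k - b k) ^ 2)
        + α * (∑ i, ψ ((∑ j ∈ g i, |x j| ^ p) ^ (1 / p))))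
    (κ : ℝ) (hκpos : 0 < κ) (hκ : α * ψ'' κ + N ^ 2 < 0)
    (xstar : Fin n → ℝ) (hmin : IsLocalMin E xstar)
    (y : Fin n → ℝ)
    (hdist : (∑ j, |xstar j - y j| ^ p) ^ (1 / p) < κ) :
    (∀ i : Fin r, (∀ j ∈ g i, y j = 0) → ∀ j ∈ g i, xstar j = 0) ∧
    {i : Fin r | ∃ j ∈ g i, xstar j ≠ 0} ⊆ {i : Fin r | ∃ j ∈ g i, y j ≠ 0} := by
  have hp : 0 < p := by linarith
  have main : ∀ i : Fin r, (∀ j ∈ g i, y j = 0) → ∀ j ∈ g i, xstar j = 0 := by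
    intro i hy j₀ hj₀
    by_contra hx
    set t := (∑ j ∈ g i, |xstar j| ^ p) ^ (1 / p) with ht
    have ht0 : 0 < t := (abs_pos.mpr hx).trans_le (abs_le_lp_norm (g i) xstar hp hj₀)
    have htκ : t < κ := by
      refine lt_of_le_of_lt (Real.rpow_le_rpow (Finset.sum_nonneg fun _ _ =>
        Real.rpow_nonneg (abs_nonneg _) _) ?_ (by positivity)) hdist
      calc ∑ j ∈ g i, |xstar j| ^ p = ∑ j ∈ g i, |xstar j - y j| ^ p :=
            Finset.sum_congr rfl fun j hj => by rw [hy j hj, sub_zero]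
        _ ≤ _ := Finset.sum_le_sum_of_subset_of_nonneg (Finset.subset_univ _)
            fun _ _ _ => Real.rpow_nonneg (abs_nonneg _) _
    set d : Fin n → ℝ := fun j => if j ∈ g i then xstar j else 0 with hd
    have hd_sq : ∑ j, d j ^ 2 ≤ t ^ 2 := by
      refine le_trans (le_of_eq ?_) (sum_sq_le_lp_norm_sq (g i) xstar hp hp2)
      simp [hd, ite_pow, Finset.sum_ite_mem]
    have hAd : ∑ k, A.mulVec d k ^ 2 ≤ N ^ 2 * t ^ 2 := by
      have h := pow_le_pow_left₀ (Real.sqrt_nonneg _) (hN d) 2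
      rw [mul_pow, Real.sq_sqrt (Finset.sum_nonneg fun _ _ => sq_nonneg _),
        Real.sq_sqrt (Finset.sum_nonneg fun _ _ => sq_nonneg _)] at h
      exact h.trans (mul_le_mul_of_nonneg_left hd_sq (sq_nonneg N))
    have hψκ : α * ψ'' t ≤ α * ψ'' κ :=
      mul_le_mul_of_nonneg_left (hmono ht0 hκpos htκ.le) hα.le
    refine not_isLocalMin_quadratic_add_comp (fun k => A.mulVec xstar k - b k) (A.mulVec d)
      (C := ∑ i' ∈ Finset.univ.erase i, ψ ((∑ j ∈ g i', |xstar j| ^ p) ^ (1 / p))) (α := α)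
      ht0 hd1 (hd2 t ht0) (by nlinarith [pow_pos ht0 2]) ?_
    have hline : IsLocalMin (fun s : ℝ => E (xstar + s • d)) 0 := by
      have hcont : ContinuousAt (fun s : ℝ => xstar + s • d) 0 := by fun_prop
      refine IsLocalMin.comp_continuous (f := E) (g := fun s : ℝ => xstar + s • d) ?_ hcont
      simpa using hmin
    refine hline.congr ?_
    filter_upwards [lt_mem_nhds (show (-1 : ℝ) < 0 by norm_num)] with s hs
    rw [hE, ← Finset.add_sum_erase _ _ (Finset.mem_univ i), ht,
      ← lp_norm_smul (g i) xstar hp (by linarith : 0 ≤ 1 + s)]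
    congr 2
    · refine Finset.sum_congr rfl fun k _ => ?_
      rw [Matrix.mulVec_add, Matrix.mulVec_smul]
      simp only [Pi.add_apply, Pi.smul_apply, smul_eq_mul]
      ring
    · congr 1
      · congr 2
        refine Finset.sum_congr rfl fun j hj => ?_
        simp [hd, hj, add_mul]
      · refine Finset.sum_congr rfl fun i' hi' => ?_
        congr 2
        refine Finset.sum_congr rfl fun j hj => ?_
        have hj' : j ∉ g i :=
          Finset.disjoint_left.mp (hdisj i' i (Finset.ne_of_mem_erase hi')) hj
        simp [hd, hj']
  refine ⟨main, ?_⟩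
  rintro i ⟨j, hj, hx⟩
  by_contra h
  exact hx (main i (fun j hj => by_contra fun hy => h ⟨j, hj, hy⟩) j hj)
end

section
/- (Majorization sandwich for the linearized surrogate.) Let ψ : [0,∞) → [0,∞) be concave with ψ(0) = 0 and differentiable on (0,∞), let α > 0, p ≥ 1, β ≥ 0, t ∈ [0,1], and let v, w ∈ ℝ^n with group support S = S(w). Define z ∈ ℝ^n by z_{g_i} = w_{g_i} + t(w_{g_i} − v_{g_i}) for i ∈ S and z_{g_i} = 0 for i ∉ S, and define the surrogate F(x) = (1/2)‖Az − b‖₂² + (x − z)ᵀAᵀ(Az − b) + (β/2)‖x − z‖₂² + α ∑_{i∈S} [ψ(‖w_{g_i}‖_p) + ψ'(‖w_{g_i}‖_p)(‖x_{g_i}‖_p − ‖w_{g_i}‖_p)]. Then: (a) F(w) ≤ E(w) + (β/2)t²‖w − v‖₂²; and (b) for every x ∈ ℝ^n with x_{g_i} = 0 for all i ∉ S, F(x) ≥ E(x) + ((β − ‖AᵀA‖₂)/2)‖x − z‖₂². -/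
/-- A concave function on `[0, ∞)` lies below its tangent line at any point of `(0, ∞)`. -/
theorem ConcaveOn.le_tangent_of_hasDerivAt {f : ℝ → ℝ} {f' a s : ℝ}
    (hf : ConcaveOn ℝ (Set.Ici 0) f) (ha : 0 < a) (hs : 0 ≤ s) (hd : HasDerivAt f f' a) :
    f s ≤ f a + f' * (s - a) := by
  rcases lt_trichotomy s a with h | h | h
  · have := hf.le_slope_of_hasDerivAt (Set.mem_Ici.2 hs) (Set.mem_Ici.2 ha.le) h hd
    rw [slope_def_field, le_div_iff₀ (sub_pos.2 h)] at this
    linarith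
  · simp [h]
  · have := hf.slope_le_of_hasDerivAt (Set.mem_Ici.2 ha.le) (Set.mem_Ici.2 hs) h hd
    rw [slope_def_field, div_le_iff₀ (sub_pos.2 h)] at this
    linarith

/-- Exact second-order expansion of the least-squares term around `z`. -/
theorem Matrix.half_sum_sq_mulVec_sub_eq {ι κ : Type*} [Fintype ι] [Fintype κ]
    (A : Matrix ι κ ℝ) (b : ι → ℝ) (x z : κ → ℝ) :
    1 / 2 * (∑ k, (A.mulVec x k - b k) ^ 2) =
      1 / 2 * (∑ k, (A.mulVec z k - b k) ^ 2)
        + (∑ j, (x j - z j) * A.transpose.mulVec (A.mulVec z - b) j)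
        + 1 / 2 * (∑ k, (A.mulVec (x - z) k) ^ 2) := by
  have hcross : (∑ j, (x j - z j) * A.transpose.mulVec (A.mulVec z - b) j)
      = ∑ k, A.mulVec (x - z) k * (A.mulVec z k - b k) := by
    change (x - z) ⬝ᵥ A.transpose.mulVec (A.mulVec z - b)
      = A.mulVec (x - z) ⬝ᵥ (A.mulVec z - b)
    rw [Matrix.dotProduct_mulVec, Matrix.vecMul_transpose]
  rw [hcross, Finset.mul_sum, Finset.mul_sum, Finset.mul_sum, ← Finset.sum_add_distrib,
    ← Finset.sum_add_distrib]
  refine Finset.sum_congr rfl fun k _ => ?_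
  rw [Matrix.mulVec_sub, Pi.sub_apply]
  ring

/-- The penalty of a vector supported on the groups in `S` only sees the groups in `S`. -/
theorem sum_group_penalty_eq {ι κ : Type*} [Fintype ι] {g : ι → Finset κ} {S : Finset ι}
    {ψ : ℝ → ℝ} {p : ℝ} {x : κ → ℝ} (hp : 1 ≤ p) (hψ0 : ψ 0 = 0)
    (hx : ∀ i ∉ S, ∀ j ∈ g i, x j = 0) :
    (∑ i, ψ ((∑ j ∈ g i, |x j| ^ p) ^ (1 / p))) =
      ∑ i ∈ S, ψ ((∑ j ∈ g i, |x j| ^ p) ^ (1 / p)) := by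
  have hp0 : p ≠ 0 := by linarith
  refine (Finset.sum_subset (Finset.subset_univ S) fun i _ hi => ?_).symm
  have h0 : (∑ j ∈ g i, |x j| ^ p) = 0 :=
    Finset.sum_eq_zero fun j hj => by rw [hx i hi j hj, abs_zero, Real.zero_rpow hp0]
  rw [h0, Real.zero_rpow (one_div_ne_zero hp0), hψ0]

/-- Majorization sandwich for the linearized surrogate.  With `ψ` concave,
`ψ(0) = 0`, differentiable on `(0,∞)`, `α > 0`, `p ≥ 1`, `β ≥ 0`, `t ∈ [0,1]`,
`S = S(w)` the group support of `w`, `z` the extrapolated point, `N` a bound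
with `‖Au‖₂² ≤ N‖u‖₂²` (valid for `N = ‖AᵀA‖₂`), and `F` the linearized
surrogate: (a) `F(w) ≤ E(w) + (β/2)t²‖w-v‖₂²`, and (b) for every `x` supported
in `S`, `F(x) ≥ E(x) + ((β-N)/2)‖x-z‖₂²`. -/
theorem stmt_11 (m n r : ℕ) (hm : 1 ≤ m) (hn : 1 ≤ n) (hr : 1 ≤ r)
    (g : Fin r → Finset (Fin n))
    (hne : ∀ i, (g i).Nonempty)
    (hdisj : ∀ i i', i ≠ i' → Disjoint (g i) (g i'))
    (hcover : ∀ j, ∃ i, j ∈ g i)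
    (A : Matrix (Fin m) (Fin n) ℝ) (b : Fin m → ℝ)
    (α p β t : ℝ) (hα : 0 < α) (hp : 1 ≤ p) (hβ : 0 ≤ β)
    (ht0 : 0 ≤ t) (ht1 : t ≤ 1)
    (ψ ψ' : ℝ → ℝ)
    (hψnn : ∀ s ∈ Set.Ici (0:ℝ), 0 ≤ ψ s)
    (hconc : ConcaveOn ℝ (Set.Ici 0) ψ)
    (hψ0 : ψ 0 = 0)
    (hd1 : ∀ s ∈ Set.Ioi (0:ℝ), HasDerivAt ψ (ψ' s) s)
    (v w : Fin n → ℝ)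
    (S : Finset (Fin r)) (hS : ∀ i, i ∈ S ↔ ∃ j ∈ g i, w j ≠ 0)
    (z : Fin n → ℝ)
    (hz : ∀ i ∈ S, ∀ j ∈ g i, z j = w j + t * (w j - v j))
    (hz0 : ∀ i ∉ S, ∀ j ∈ g i, z j = 0)
    (N : ℝ)
    (hN : ∀ u : Fin n → ℝ, (∑ k, (A.mulVec u k) ^ 2) ≤ N * (∑ j, (u j) ^ 2))
    (E F : (Fin n → ℝ) → ℝ)
    (hE : ∀ x, E x = 1 / 2 * (∑ k, (A.mulVec x k - b k) ^ 2)
        + α * (∑ i, ψ ((∑ j ∈ g i, |x j| ^ p) ^ (1 / p))))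
    (hF : ∀ x, F x = 1 / 2 * (∑ k, (A.mulVec z k - b k) ^ 2)
        + (∑ j, (x j - z j) * A.transpose.mulVec (A.mulVec z - b) j)
        + β / 2 * (∑ j, (x j - z j) ^ 2)
        + α * (∑ i ∈ S, (ψ ((∑ j ∈ g i, |w j| ^ p) ^ (1 / p))
            + ψ' ((∑ j ∈ g i, |w j| ^ p) ^ (1 / p))
              * ((∑ j ∈ g i, |x j| ^ p) ^ (1 / p)
                 - (∑ j ∈ g i, |w j| ^ p) ^ (1 / p))))) :
    F w ≤ E w + β / 2 * t ^ 2 * (∑ j, (w j - v j) ^ 2) ∧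
    ∀ x : Fin n → ℝ, (∀ i ∉ S, ∀ j ∈ g i, x j = 0) →
      E x + (β - N) / 2 * (∑ j, (x j - z j) ^ 2) ≤ F x := by
  have hw0 : ∀ i ∉ S, ∀ j ∈ g i, w j = 0 := fun i hi j hj => by
    by_contra h
    exact hi ((hS i).2 ⟨j, hj, h⟩)
  constructor
  · have hdist : (∑ j, (w j - z j) ^ 2) ≤ t ^ 2 * ∑ j, (w j - v j) ^ 2 := by
      rw [Finset.mul_sum]
      refine Finset.sum_le_sum fun j _ => ?_
      obtain ⟨i, hj⟩ := hcover j
      by_cases hi : i ∈ S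
      · rw [hz i hi j hj]
        exact le_of_eq (by ring)
      · rw [hz0 i hi j hj, hw0 i hi j hj, sub_zero, zero_pow two_ne_zero]
        positivity
    have hres : 0 ≤ ∑ k, (A.mulVec (w - z) k) ^ 2 := Finset.sum_nonneg fun k _ => sq_nonneg _
    have hdistβ := mul_le_mul_of_nonneg_left hdist (div_nonneg hβ zero_le_two)
    rw [hE, hF, sum_group_penalty_eq hp hψ0 hw0, A.half_sum_sq_mulVec_sub_eq b w z]
    simp only [sub_self, mul_zero, add_zero]
    linarith
  · intro x hx
    have hpen : (∑ i ∈ S, ψ ((∑ j ∈ g i, |x j| ^ p) ^ (1 / p))) ≤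
        ∑ i ∈ S, (ψ ((∑ j ∈ g i, |w j| ^ p) ^ (1 / p))
            + ψ' ((∑ j ∈ g i, |w j| ^ p) ^ (1 / p))
              * ((∑ j ∈ g i, |x j| ^ p) ^ (1 / p)
                 - (∑ j ∈ g i, |w j| ^ p) ^ (1 / p))) := by
      refine Finset.sum_le_sum fun i hi => ?_
      obtain ⟨j, hj, hwj⟩ := (hS i).1 hi
      have hpos : 0 < (∑ j ∈ g i, |w j| ^ p) ^ (1 / p) :=
        Real.rpow_pos_of_pos (Finset.sum_pos' (fun k _ => by positivity)
          ⟨j, hj, Real.rpow_pos_of_pos (abs_pos.2 hwj) p⟩) _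
      exact hconc.le_tangent_of_hasDerivAt hpos (by positivity) (hd1 _ hpos)
    have hpenα := mul_le_mul_of_nonneg_left hpen hα.le
    have hNx := hN (x - z)
    simp only [Pi.sub_apply] at hNx
    rw [hE, hF, sum_group_penalty_eq hp hψ0 hx, A.half_sum_sq_mulVec_sub_eq b x z]
    linarith
end

section
/- (One-step sufficient decrease, Lemma 4.1(i).) Let ψ : [0,∞) → [0,∞) be concave with ψ(0) = 0 and differentiable on (0,∞), let α > 0, p ≥ 1, ε ∈ [0,1), β ≥ ‖AᵀA‖₂, t ∈ [0,1], and let v, w, x⁺ ∈ ℝ^n with S := S(w) and x⁺_{g_i} = 0 for all i ∉ S. Define z ∈ ℝ^n by z_{g_i} = w_{g_i} + t(w_{g_i} − v_{g_i}) for i ∈ S and z_{g_i} = 0 for i ∉ S, and for i ∈ S define J_i(u) = ⟨u − z_{g_i}, (Aᵀ(Az − b))_{g_i}⟩ + (β/2)‖u − z_{g_i}‖₂² + α[ψ(‖w_{g_i}‖_p) + ψ'(‖w_{g_i}‖_p)(‖u‖_p − ‖w_{g_i}‖_p)] for u ∈ ℝ^{g_i}. Assume there exist vectors λ_i ∈ ℝ^{g_i}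 (i ∈ S) such that J_i(w_{g_i}) ≥ J_i(x⁺_{g_i}) + ⟨λ_i, w_{g_i} − x⁺_{g_i}⟩ + (β/2)‖w_{g_i} − x⁺_{g_i}‖₂² for each i ∈ S, and (∑_{i∈S} ‖λ_i‖₂²)^{1/2} ≤ (βε/2)‖x⁺ − w‖₂. Then, with H(x,u) := E(x) + (β(1−ε)/2)‖x − u‖₂², one has H(w,v) − H(x⁺,w) ≥ (−(‖AᵀA‖₂/2)t² − ((β − ‖AᵀA‖₂)/2)t + β(1−ε)/2)·‖w − v‖₂². -/
/-- A concave function lies below its tangent line at any point of differentiability. -/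
lemma ConcaveOn.le_tangent_of_hasDerivAt_s12 {f : ℝ → ℝ} {s : Set ℝ} (hf : ConcaveOn ℝ s f)
    {x y d : ℝ} (hx : x ∈ s) (hy : y ∈ s) (hd : HasDerivAt f d x) :
    f y ≤ f x + d * (y - x) := by
  rcases lt_trichotomy x y with h | h | h
  · have := hf.slope_le_of_hasDerivAt hx hy h hd
    rw [slope_def_field, div_le_iff₀ (sub_pos.2 h)] at this
    linarith
  · simp [h]
  · have := hf.le_slope_of_hasDerivAt hy hx h hd
    rw [slope_def_field, le_div_iff₀ (sub_pos.2 h)] at this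
    linarith

/-- Summation over groups: a sum whose terms vanish off the groups indexed by `S`. -/
lemma sum_eq_sum_groups {ι κ : Type*} [Fintype ι] [Fintype κ] [DecidableEq ι]
    (g : κ → Finset ι) (hdisj : ∀ i i', i ≠ i' → Disjoint (g i) (g i'))
    (hcover : ∀ j, ∃ i, j ∈ g i) (S : Finset κ) (f : ι → ℝ)
    (hf : ∀ i ∉ S, ∀ j ∈ g i, f j = 0) :
    ∑ j, f j = ∑ i ∈ S, ∑ j ∈ g i, f j := by
  have huniv : (Finset.univ : Finset ι) = Finset.univ.biUnion g := by
    ext j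
    simpa using hcover j
  rw [huniv, Finset.sum_biUnion fun i _ i' _ h => hdisj i i' h]
  exact (Finset.sum_subset (Finset.subset_univ S)
    fun i _ hi => Finset.sum_eq_zero (hf i hi)).symm

/-- Restricting a sum of nonnegative terms to a family of disjoint groups decreases it. -/
lemma sum_groups_le_sum {ι κ : Type*} [Fintype ι] [DecidableEq ι]
    (g : κ → Finset ι) (hdisj : ∀ i i', i ≠ i' → Disjoint (g i) (g i'))
    (S : Finset κ) (f : ι → ℝ) (hf : ∀ j, 0 ≤ f j) :
    ∑ i ∈ S, ∑ j ∈ g i, f j ≤ ∑ j, f j := by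
  rw [← Finset.sum_biUnion fun i _ i' _ h => hdisj i i' h]
  exact Finset.sum_le_sum_of_subset_of_nonneg (Finset.subset_univ _) fun j _ _ => hf j

/-- Exact second-order expansion of the least-squares functional. -/
lemma half_sum_sq_residual_expansion {ι κ : Type*} [Fintype ι] [Fintype κ]
    (A : Matrix κ ι ℝ) (b : κ → ℝ) (x z : ι → ℝ) :
    1 / 2 * ∑ k, (A.mulVec x k - b k) ^ 2 = 1 / 2 * ∑ k, (A.mulVec z k - b k) ^ 2
      + ∑ j, (x j - z j) * A.transpose.mulVec (A.mulVec z - b) j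
      + 1 / 2 * ∑ k, (A.mulVec (x - z) k) ^ 2 := by
  have h : ∑ j, (x j - z j) * A.transpose.mulVec (A.mulVec z - b) j
      = ∑ k, A.mulVec (x - z) k * (A.mulVec z k - b k) := by
    change (x - z) ⬝ᵥ A.transpose.mulVec (A.mulVec z - b) = A.mulVec (x - z) ⬝ᵥ (A.mulVec z - b)
    rw [Matrix.dotProduct_mulVec, Matrix.vecMul_transpose]
  rw [h, Finset.mul_sum, Finset.mul_sum, Finset.mul_sum, ← Finset.sum_add_distrib,
    ← Finset.sum_add_distrib]
  refine Finset.sum_congr rfl fun k _ => ?_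
  rw [Matrix.mulVec_sub, Pi.sub_apply]
  ring

/-- Group-wise `ψ`-penalties of a vector supported on the groups in `S`. -/
lemma sum_penalty_eq_sum_support {ι κ : Type*} [Fintype κ] (g : κ → Finset ι) (S : Finset κ)
    {ψ : ℝ → ℝ} (hψ0 : ψ 0 = 0) {p : ℝ} (hp : p ≠ 0) (x : ι → ℝ)
    (hx : ∀ i ∉ S, ∀ j ∈ g i, x j = 0) :
    ∑ i, ψ ((∑ j ∈ g i, |x j| ^ p) ^ (1 / p))
      = ∑ i ∈ S, ψ ((∑ j ∈ g i, |x j| ^ p) ^ (1 / p)) := by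
  refine (Finset.sum_subset (Finset.subset_univ S) fun i _ hi => ?_).symm
  have h : ∑ j ∈ g i, |x j| ^ p = 0 := Finset.sum_eq_zero fun j hj => by
    rw [hx i hi j hj, abs_zero, Real.zero_rpow hp]
  rw [h, Real.zero_rpow (one_div_ne_zero hp), hψ0]

/-- One-step sufficient decrease (Lemma 4.1(i)).  With `ψ` concave, `ψ(0)=0`,
differentiable on `(0,∞)`, `α > 0`, `p ≥ 1`, `ε ∈ [0,1)`, `N` satisfying
`‖Au‖₂² ≤ N‖u‖₂²` (valid for `N = ‖AᵀA‖₂`), `β ≥ N`, `t ∈ [0,1]`,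
`S = S(w)`, `x⁺` supported in `S`, `z` the extrapolated point, `Jᵢ` the
groupwise surrogates, and inexact strong-convexity certificates `λᵢ` with
`‖λ_S‖₂ ≤ (βε/2)‖x⁺-w‖₂`: for `H(x,u) = E(x) + (β(1-ε)/2)‖x-u‖₂²` one has
`H(w,v) - H(x⁺,w) ≥ (-(N/2)t² - ((β-N)/2)t + β(1-ε)/2)·‖w-v‖₂²`. -/
theorem stmt_12 (m n r : ℕ) (hm : 1 ≤ m) (hn : 1 ≤ n) (hr : 1 ≤ r)
    (g : Fin r → Finset (Fin n))
    (hne : ∀ i, (g i).Nonempty)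
    (hdisj : ∀ i i', i ≠ i' → Disjoint (g i) (g i'))
    (hcover : ∀ j, ∃ i, j ∈ g i)
    (A : Matrix (Fin m) (Fin n) ℝ) (b : Fin m → ℝ)
    (α p ε β t : ℝ) (hα : 0 < α) (hp : 1 ≤ p)
    (hε0 : 0 ≤ ε) (hε1 : ε < 1)
    (ht0 : 0 ≤ t) (ht1 : t ≤ 1)
    (ψ ψ' : ℝ → ℝ)
    (hψnn : ∀ s ∈ Set.Ici (0:ℝ), 0 ≤ ψ s)
    (hconc : ConcaveOn ℝ (Set.Ici 0) ψ)
    (hψ0 : ψ 0 = 0)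
    (hd1 : ∀ s ∈ Set.Ioi (0:ℝ), HasDerivAt ψ (ψ' s) s)
    (N : ℝ)
    (hN : ∀ u : Fin n → ℝ, (∑ k, (A.mulVec u k) ^ 2) ≤ N * (∑ j, (u j) ^ 2))
    (hβ : N ≤ β)
    (v w xp : Fin n → ℝ)
    (S : Finset (Fin r)) (hS : ∀ i, i ∈ S ↔ ∃ j ∈ g i, w j ≠ 0)
    (hxp0 : ∀ i ∉ S, ∀ j ∈ g i, xp j = 0)
    (z : Fin n → ℝ)
    (hz : ∀ i ∈ S, ∀ j ∈ g i, z j = w j + t * (w j - v j))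
    (hz0 : ∀ i ∉ S, ∀ j ∈ g i, z j = 0)
    (J : Fin r → (Fin n → ℝ) → ℝ)
    (hJ : ∀ i ∈ S, ∀ u : Fin n → ℝ, J i u =
        (∑ j ∈ g i, (u j - z j) * A.transpose.mulVec (A.mulVec z - b) j)
        + β / 2 * (∑ j ∈ g i, (u j - z j) ^ 2)
        + α * (ψ ((∑ j ∈ g i, |w j| ^ p) ^ (1 / p))
            + ψ' ((∑ j ∈ g i, |w j| ^ p) ^ (1 / p))
              * ((∑ j ∈ g i, |u j| ^ p) ^ (1 / p)
                 - (∑ j ∈ g i, |w j| ^ p) ^ (1 / p))))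
    (lam : Fin n → ℝ)
    (hsc : ∀ i ∈ S, J i xp + (∑ j ∈ g i, lam j * (w j - xp j))
        + β / 2 * (∑ j ∈ g i, (w j - xp j) ^ 2) ≤ J i w)
    (hlam : Real.sqrt (∑ i ∈ S, ∑ j ∈ g i, (lam j) ^ 2)
        ≤ β * ε / 2 * Real.sqrt (∑ j, (xp j - w j) ^ 2))
    (E : (Fin n → ℝ) → ℝ)
    (hE : ∀ x, E x = 1 / 2 * (∑ k, (A.mulVec x k - b k) ^ 2)
        + α * (∑ i, ψ ((∑ j ∈ g i, |x j| ^ p) ^ (1 / p))))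
    (H : (Fin n → ℝ) → (Fin n → ℝ) → ℝ)
    (hH : ∀ x u, H x u = E x + β * (1 - ε) / 2 * (∑ j, (x j - u j) ^ 2)) :
    (-(N / 2) * t ^ 2 - (β - N) / 2 * t + β * (1 - ε) / 2)
        * (∑ j, (w j - v j) ^ 2) ≤ H w v - H xp w := by
  have hp0 : p ≠ 0 := by linarith
  have hN0 : 0 ≤ N := by
    have h := hN fun _ => 1
    have hn' : (1 : ℝ) ≤ n := by exact_mod_cast hn
    simp only [one_pow, Finset.sum_const, Finset.card_univ, Fintype.card_fin, nsmul_eq_mul,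
      mul_one] at h
    have h0 : 0 ≤ ∑ k, (A.mulVec (fun _ => 1) k) ^ 2 := Finset.sum_nonneg fun k _ => sq_nonneg _
    by_contra hneg
    nlinarith
  have hw0 : ∀ i ∉ S, ∀ j ∈ g i, w j = 0 := fun i hi j hj => by
    by_contra h
    exact hi ((hS i).2 ⟨j, hj, h⟩)
  have hsum := sum_eq_sum_groups g hdisj hcover S
  have htan : ∀ i ∈ S, ψ ((∑ j ∈ g i, |xp j| ^ p) ^ (1 / p))
      ≤ ψ ((∑ j ∈ g i, |w j| ^ p) ^ (1 / p)) + ψ' ((∑ j ∈ g i, |w j| ^ p) ^ (1 / p))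
        * ((∑ j ∈ g i, |xp j| ^ p) ^ (1 / p) - (∑ j ∈ g i, |w j| ^ p) ^ (1 / p)) := by
    intro i hi
    obtain ⟨j, hj, hwj⟩ := (hS i).1 hi
    have hpos : 0 < (∑ j ∈ g i, |w j| ^ p) ^ (1 / p) :=
      Real.rpow_pos_of_pos (Finset.sum_pos' (fun j _ => Real.rpow_nonneg (abs_nonneg _) _)
        ⟨j, hj, Real.rpow_pos_of_pos (abs_pos.2 hwj) _⟩) _
    exact hconc.le_tangent_of_hasDerivAt_s12 hpos.le
      (Real.rpow_nonneg (Finset.sum_nonneg fun j _ => Real.rpow_nonneg (abs_nonneg _) _) _)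
      (hd1 _ hpos)
  have hgxp := hsum (fun j => (xp j - z j) * A.transpose.mulVec (A.mulVec z - b) j)
    fun i hi j hj => by simp [hxp0 i hi j hj, hz0 i hi j hj]
  have hgw := hsum (fun j => (w j - z j) * A.transpose.mulVec (A.mulVec z - b) j)
    fun i hi j hj => by simp [hw0 i hi j hj, hz0 i hi j hj]
  have hqxp := hsum (fun j => (xp j - z j) ^ 2)
    fun i hi j hj => by simp [hxp0 i hi j hj, hz0 i hi j hj]
  have hqw := hsum (fun j => (w j - z j) ^ 2)
    fun i hi j hj => by simp [hw0 i hi j hj, hz0 i hi j hj]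
  have hqwx := hsum (fun j => (w j - xp j) ^ 2)
    fun i hi j hj => by simp [hw0 i hi j hj, hxp0 i hi j hj]
  have hsymm : ∑ j, (xp j - w j) ^ 2 = ∑ j, (w j - xp j) ^ 2 :=
    Finset.sum_congr rfl fun j _ => by ring
  have hJxp : ∑ j, (xp j - z j) * A.transpose.mulVec (A.mulVec z - b) j
      + β / 2 * ∑ j, (xp j - z j) ^ 2
      + α * ∑ i, ψ ((∑ j ∈ g i, |xp j| ^ p) ^ (1 / p)) ≤ ∑ i ∈ S, J i xp := by
    rw [hgxp, hqxp, sum_penalty_eq_sum_support g S hψ0 hp0 xp hxp0, Finset.mul_sum,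
      Finset.mul_sum, ← Finset.sum_add_distrib, ← Finset.sum_add_distrib]
    refine Finset.sum_le_sum fun i hi => ?_
    rw [hJ i hi]
    exact add_le_add_right (mul_le_mul_of_nonneg_left (htan i hi) hα.le) _
  have hJw : ∑ i ∈ S, J i w = ∑ j, (w j - z j) * A.transpose.mulVec (A.mulVec z - b) j
      + β / 2 * ∑ j, (w j - z j) ^ 2
      + α * ∑ i, ψ ((∑ j ∈ g i, |w j| ^ p) ^ (1 / p)) := by
    rw [hgw, hqw, sum_penalty_eq_sum_support g S hψ0 hp0 w hw0, Finset.mul_sum,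
      Finset.mul_sum, ← Finset.sum_add_distrib, ← Finset.sum_add_distrib]
    refine Finset.sum_congr rfl fun i hi => ?_
    rw [hJ i hi, sub_self, mul_zero, add_zero]
  have hdescent : ∑ i ∈ S, J i xp + ∑ i ∈ S, ∑ j ∈ g i, lam j * (w j - xp j)
      + β / 2 * ∑ j, (w j - xp j) ^ 2 ≤ ∑ i ∈ S, J i w := by
    rw [hqwx, Finset.mul_sum, ← Finset.sum_add_distrib, ← Finset.sum_add_distrib]
    exact Finset.sum_le_sum hsc
  have hlam_inner : -(β * ε / 2 * ∑ j, (w j - xp j) ^ 2)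
      ≤ ∑ i ∈ S, ∑ j ∈ g i, lam j * (w j - xp j) := by
    have hCS := Real.sum_mul_le_sqrt_mul_sqrt (S.biUnion g) (fun j => -lam j)
      (fun j => w j - xp j)
    simp only [Finset.sum_biUnion fun i _ i' _ h => hdisj i i' h, neg_mul, neg_sq,
      Finset.sum_neg_distrib] at hCS
    rw [← hqwx] at hCS
    rw [hsymm] at hlam
    have h := mul_le_mul_of_nonneg_right hlam (Real.sqrt_nonneg (∑ j, (w j - xp j) ^ 2))
    rw [mul_assoc, Real.mul_self_sqrt (Finset.sum_nonneg fun j _ => sq_nonneg _)] at h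
    linarith
  have hwz : ∑ j, (w j - z j) ^ 2 ≤ t ^ 2 * ∑ j, (w j - v j) ^ 2 := by
    have h : ∑ i ∈ S, ∑ j ∈ g i, (w j - z j) ^ 2
        = t ^ 2 * ∑ i ∈ S, ∑ j ∈ g i, (w j - v j) ^ 2 := by
      simp only [Finset.mul_sum]
      refine Finset.sum_congr rfl fun i hi => Finset.sum_congr rfl fun j hj => ?_
      rw [hz i hi j hj]
      ring
    rw [hqw, h]
    exact mul_le_mul_of_nonneg_left
      (sum_groups_le_sum g hdisj S _ fun j => sq_nonneg _) (sq_nonneg t)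
  have hFxp := half_sum_sq_residual_expansion A b xp z
  have hFw := half_sum_sq_residual_expansion A b w z
  have hAw : 0 ≤ ∑ k, (A.mulVec (w - z) k) ^ 2 := Finset.sum_nonneg fun k _ => sq_nonneg _
  have hAxp := hN (xp - z)
  simp only [Pi.sub_apply] at hAxp
  have hqxp0 : 0 ≤ ∑ j, (xp j - z j) ^ 2 := Finset.sum_nonneg fun j _ => sq_nonneg _
  have hD0 : 0 ≤ ∑ j, (w j - v j) ^ 2 := Finset.sum_nonneg fun j _ => sq_nonneg _
  have hextra := mul_nonneg (sub_nonneg.2 hβ) hqxp0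
  have hβwz := mul_le_mul_of_nonneg_left hwz (hN0.trans hβ)
  have ht : 0 ≤ (β - N) * (t * (1 - t)) * ∑ j, (w j - v j) ^ 2 :=
    mul_nonneg (mul_nonneg (sub_nonneg.2 hβ) (mul_nonneg ht0 (sub_nonneg.2 ht1))) hD0
  rw [hH, hH, hE, hE, hsymm]
  linarith
end

section
/- (One-step uniform lower bound for nonzero groups, Lemma 4.2(ii), case p > 1.) Let p > 1, α > 0, β > 0, ε ∈ [0,1), t ∈ [0,1], and let ψ be differentiable on (0,∞) with ψ' ≥ 0 there. Let v, w, x⁺ ∈ ℝ^n and S ⊆ {1,…,r} be such that v, w, x⁺ all vanish on every group outside S, and w_{g_i} ≠ 0 and x⁺_{g_i} ≠ 0 for every i ∈ S. Set z = w + t(w − v), and assume λ ∈ ℝ^n satisfies, for every i ∈ S and every j ∈ g_i, λ_j = (Aᵀ(Az − b))_j + β(x⁺ − z)_j + α ψ'(‖w_{g_i}‖_p)·‖x⁺_{g_i}‖_p^{1−p}·|x⁺_j|^{p−1}·sgn(x⁺_j), with (∑_{i∈S} ‖λ_{g_i}‖₂²)^{1/2} ≤ (βε/2)‖x⁺ −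 w‖₂. If moreover M > 0 satisfies ‖x⁺ − w‖₂ ≤ √(2M/(β(1−ε))), ‖w − v‖₂ ≤ √(2M/(β(1−ε))), and ‖Aw − b‖₂ ≤ √(2M), then for every i ∈ S: ψ'(‖w_{g_i}‖_p) ≤ √n·(2‖AᵀA‖₂ + β(4+ε) + 2‖A‖₂·√(β(1−ε)))·√M / (α·√(2β(1−ε))). -/
/-- Comparison of the `ℓ₁` norm on a subset of coordinates with the full `ℓ₂` norm. -/
lemma sum_abs_le_sqrt_mul_sqrt {n : ℕ} (s : Finset (Fin n)) (f : Fin n → ℝ) :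
    ∑ j ∈ s, |f j| ≤ Real.sqrt n * Real.sqrt (∑ j ∈ s, f j ^ 2) := by
  rw [← Real.sqrt_mul (Nat.cast_nonneg n)]
  apply Real.le_sqrt_of_sq_le
  have hcs := sq_sum_le_card_mul_sum_sq (s := s) (f := fun j => |f j|)
  simp only [sq_abs] at hcs
  refine hcs.trans (mul_le_mul_of_nonneg_right ?_ (Finset.sum_nonneg fun _ _ => sq_nonneg _))
  have hcard : s.card ≤ n := by simpa using Finset.card_le_univ s
  exact_mod_cast hcard

lemma sum_abs_le_of_sqrt_le {n : ℕ} (s : Finset (Fin n)) (f : Fin n → ℝ) {C : ℝ}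
    (h : Real.sqrt (∑ j, f j ^ 2) ≤ C) : ∑ j ∈ s, |f j| ≤ Real.sqrt n * C := by
  refine (sum_abs_le_sqrt_mul_sqrt s f).trans
    (mul_le_mul_of_nonneg_left (le_trans (Real.sqrt_le_sqrt ?_) h) (Real.sqrt_nonneg _))
  exact Finset.sum_le_univ_sum_of_nonneg fun _ => sq_nonneg _

lemma sum_abs_rpow_pos {ι : Type*} (s : Finset ι) (x : ι → ℝ) (p : ℝ)
    (hx : ∃ j ∈ s, x j ≠ 0) : 0 < ∑ j ∈ s, |x j| ^ p := by
  obtain ⟨j, hj, hxj⟩ := hx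
  exact Finset.sum_pos' (fun _ _ => Real.rpow_nonneg (abs_nonneg _) _)
    ⟨j, hj, Real.rpow_pos_of_pos (abs_pos.mpr hxj) _⟩

/-- The gradient of the `ℓ_p` norm at a nonzero point has `ℓ₁` norm at least one. -/
lemma one_le_sum_lp_norm_gradient {ι : Type*} (s : Finset ι) (x : ι → ℝ) {p : ℝ} (hp : 1 < p)
    (hx : ∃ j ∈ s, x j ≠ 0) :
    1 ≤ ∑ j ∈ s, ((∑ j' ∈ s, |x j'| ^ p) ^ (1 / p)) ^ (1 - p) * |x j| ^ (p - 1) := by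
  have hp0 : 0 < p := by linarith
  have hpos := sum_abs_rpow_pos s x p hx
  set X := (∑ j' ∈ s, |x j'| ^ p) ^ (1 / p) with hX
  have hX0 : 0 < X := Real.rpow_pos_of_pos hpos _
  have hXp : X ^ p = ∑ j' ∈ s, |x j'| ^ p := by
    rw [hX, ← Real.rpow_mul hpos.le, one_div_mul_cancel hp0.ne', Real.rpow_one]
  have hle : ∀ j ∈ s, |x j| ≤ X := fun j hj => by
    refine (Real.rpow_le_rpow_iff (abs_nonneg _) hX0.le hp0).mp ?_
    rw [hXp]
    exact Finset.single_le_sum (f := fun j => |x j| ^ p)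
      (fun _ _ => Real.rpow_nonneg (abs_nonneg _) _) hj
  have hterm : ∀ j ∈ s, |x j| ^ p ≤ X * |x j| ^ (p - 1) := fun j hj => by
    have hsplit : |x j| ^ p = |x j| * |x j| ^ (p - 1) := by
      rw [← Real.rpow_one_add' (abs_nonneg _) (by linarith)]
      congr 1
      ring
    rw [hsplit]
    exact mul_le_mul_of_nonneg_right (hle j hj) (Real.rpow_nonneg (abs_nonneg _) _)
  have hsum := Finset.sum_le_sum hterm
  rw [← hXp, ← Finset.mul_sum] at hsum
  rw [← Finset.mul_sum]
  have hXm : X ^ p = X * X ^ (p - 1) := by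
    rw [← Real.rpow_one_add' hX0.le (by linarith)]
    congr 1
    ring
  rw [hXm] at hsum
  have hkey := le_of_mul_le_mul_left hsum hX0
  calc (1 : ℝ) = X ^ (1 - p) * X ^ (p - 1) := by
        rw [← Real.rpow_add hX0]
        simp
    _ ≤ _ := mul_le_mul_of_nonneg_left hkey (Real.rpow_nonneg hX0.le _)

lemma abs_rpow_mul_sign {q : ℝ} (hq : 0 < q) (x : ℝ) :
    |(|x| ^ q * Real.sign x)| = |x| ^ q := by
  rw [abs_mul, abs_of_nonneg (Real.rpow_nonneg (abs_nonneg _) _)]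
  rcases eq_or_ne x 0 with rfl | hx
  · simp [Real.zero_rpow hq.ne']
  · rcases Real.sign_apply_eq_of_ne_zero x hx with h | h <;> simp [h]

/-- A constant bounding the growth of a map between Euclidean spaces is nonnegative. -/
lemma nonneg_of_sqrt_le_mul_sqrt {n k : ℕ} (hn : 1 ≤ n) (F : (Fin n → ℝ) → Fin k → ℝ) {N : ℝ}
    (h : ∀ u : Fin n → ℝ, Real.sqrt (∑ j, F u j ^ 2) ≤ N * Real.sqrt (∑ j, u j ^ 2)) :
    0 ≤ N := by
  have hu := (Real.sqrt_nonneg _).trans (h fun _ => 1)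
  have hn' : (0 : ℝ) < n := by exact_mod_cast hn
  refine nonneg_of_mul_nonneg_left hu (Real.sqrt_pos.mpr ?_)
  simpa using hn'


/-- One-step uniform lower bound for nonzero groups (Lemma 4.2(ii), case
`p > 1`).  With `v, w, x⁺` supported in `S`, all groups in `S` nonzero for `w`
and `x⁺`, `z = w + t(w - v)`, the first-order certificate `λ` satisfying the
stated formula on groups in `S` with `‖λ_S‖₂ ≤ (βε/2)‖x⁺ - w‖₂`, spectral-norm
bounds `NA` for `A` (and `Aᵀ`) and `NAtA` for `AᵀA`, and `M > 0` bounding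
`‖x⁺-w‖₂, ‖w-v‖₂ ≤ √(2M/(β(1-ε)))`, `‖Aw-b‖₂ ≤ √(2M)`: for every `i ∈ S`,
`ψ'(‖w_{gᵢ}‖_p) ≤ √n (2NAtA + β(4+ε) + 2NA√(β(1-ε))) √M / (α√(2β(1-ε)))`. -/
theorem stmt_16 (m n r : ℕ) (hm : 1 ≤ m) (hn : 1 ≤ n) (hr : 1 ≤ r)
    (g : Fin r → Finset (Fin n))
    (hne : ∀ i, (g i).Nonempty)
    (hdisj : ∀ i i', i ≠ i' → Disjoint (g i) (g i'))
    (hcover : ∀ j, ∃ i, j ∈ g i)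
    (A : Matrix (Fin m) (Fin n) ℝ) (b : Fin m → ℝ)
    (p α β ε t : ℝ) (hp : 1 < p) (hα : 0 < α) (hβ : 0 < β)
    (hε0 : 0 ≤ ε) (hε1 : ε < 1) (ht0 : 0 ≤ t) (ht1 : t ≤ 1)
    (ψ ψ' : ℝ → ℝ)
    (hd1 : ∀ s ∈ Set.Ioi (0:ℝ), HasDerivAt ψ (ψ' s) s)
    (hd1nn : ∀ s ∈ Set.Ioi (0:ℝ), 0 ≤ ψ' s)
    (v w xp : Fin n → ℝ) (S : Finset (Fin r))
    (hv0 : ∀ i ∉ S, ∀ j ∈ g i, v j = 0)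
    (hw0 : ∀ i ∉ S, ∀ j ∈ g i, w j = 0)
    (hxp0 : ∀ i ∉ S, ∀ j ∈ g i, xp j = 0)
    (hwS : ∀ i ∈ S, ∃ j ∈ g i, w j ≠ 0)
    (hxpS : ∀ i ∈ S, ∃ j ∈ g i, xp j ≠ 0)
    (z : Fin n → ℝ) (hz : ∀ j, z j = w j + t * (w j - v j))
    (lam : Fin n → ℝ)
    (hlam : ∀ i ∈ S, ∀ j ∈ g i, lam j =
        A.transpose.mulVec (A.mulVec z - b) j + β * (xp j - z j)
        + α * ψ' ((∑ j' ∈ g i, |w j'| ^ p) ^ (1 / p))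
            * ((∑ j' ∈ g i, |xp j'| ^ p) ^ (1 / p)) ^ (1 - p)
            * |xp j| ^ (p - 1) * Real.sign (xp j))
    (hlamb : Real.sqrt (∑ i ∈ S, ∑ j ∈ g i, (lam j) ^ 2)
        ≤ β * ε / 2 * Real.sqrt (∑ j, (xp j - w j) ^ 2))
    (NA NAtA : ℝ)
    (hNA : ∀ u : Fin n → ℝ,
      Real.sqrt (∑ k, (A.mulVec u k) ^ 2) ≤ NA * Real.sqrt (∑ j, (u j) ^ 2))
    (hNAT : ∀ u : Fin m → ℝ,
      Real.sqrt (∑ j, (A.transpose.mulVec u j) ^ 2)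
        ≤ NA * Real.sqrt (∑ k, (u k) ^ 2))
    (hNAtA : ∀ u : Fin n → ℝ,
      Real.sqrt (∑ j, (A.transpose.mulVec (A.mulVec u) j) ^ 2)
        ≤ NAtA * Real.sqrt (∑ j, (u j) ^ 2))
    (M : ℝ) (hM : 0 < M)
    (h1 : Real.sqrt (∑ j, (xp j - w j) ^ 2) ≤ Real.sqrt (2 * M / (β * (1 - ε))))
    (h2 : Real.sqrt (∑ j, (w j - v j) ^ 2) ≤ Real.sqrt (2 * M / (β * (1 - ε))))
    (h3 : Real.sqrt (∑ k, (A.mulVec w k - b k) ^ 2) ≤ Real.sqrt (2 * M)) :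
    ∀ i ∈ S, ψ' ((∑ j ∈ g i, |w j| ^ p) ^ (1 / p))
      ≤ Real.sqrt n * (2 * NAtA + β * (4 + ε) + 2 * NA * Real.sqrt (β * (1 - ε)))
          * Real.sqrt M / (α * Real.sqrt (2 * β * (1 - ε))) := by
  intro i hi
  have hεpos : 0 < 1 - ε := by linarith
  have hNA0 : 0 ≤ NA := nonneg_of_sqrt_le_mul_sqrt hn _ hNA
  have hNAtA0 : 0 ≤ NAtA := nonneg_of_sqrt_le_mul_sqrt hn _ hNAtA
  set D := Real.sqrt (2 * M / (β * (1 - ε))) with hD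
  have hW0 : 0 < (∑ j ∈ g i, |w j| ^ p) ^ (1 / p) :=
    Real.rpow_pos_of_pos (sum_abs_rpow_pos _ w p (hwS i hi)) _
  set c := ψ' ((∑ j ∈ g i, |w j| ^ p) ^ (1 / p)) with hc
  have hc0 : 0 ≤ c := hd1nn _ hW0
  have hgrad := one_le_sum_lp_norm_gradient (g i) xp hp (hxpS i hi)
  set X := (∑ j' ∈ g i, |xp j'| ^ p) ^ (1 / p) with hX
  have hX0 : 0 < X := Real.rpow_pos_of_pos (sum_abs_rpow_pos _ xp p (hxpS i hi)) _
  have hzw : Real.sqrt (∑ j, ((z - w) j) ^ 2) ≤ D := by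
    refine le_trans (Real.sqrt_le_sqrt (Finset.sum_le_sum fun j _ => ?_)) h2
    have ht : t ^ 2 ≤ 1 := pow_le_one₀ ht0 ht1
    rw [Pi.sub_apply, hz j, add_sub_cancel_left, mul_pow]
    exact mul_le_of_le_one_left (sq_nonneg _) ht
  have hsplit : A.transpose.mulVec (A.mulVec z - b)
      = A.transpose.mulVec (A.mulVec (z - w)) + A.transpose.mulVec (A.mulVec w - b) := by
    rw [← Matrix.mulVec_add, Matrix.mulVec_sub A z w]
    congr 1
    abel
  have hterm : ∀ j ∈ g i, α * c * (X ^ (1 - p) * |xp j| ^ (p - 1)) ≤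
      |lam j| + |A.transpose.mulVec (A.mulVec (z - w)) j|
        + |A.transpose.mulVec (A.mulVec w - b) j| + β * |xp j - w j| + β * |(z - w) j| := by
    intro j hj
    have hq : |α * c * X ^ (1 - p) * (|xp j| ^ (p - 1) * Real.sign (xp j))|
        = α * c * (X ^ (1 - p) * |xp j| ^ (p - 1)) := by
      rw [abs_mul, abs_rpow_mul_sign (by linarith), abs_of_nonneg
        (mul_nonneg (mul_nonneg hα.le hc0) (Real.rpow_nonneg hX0.le _)), mul_assoc]
    have he : α * c * X ^ (1 - p) * (|xp j| ^ (p - 1) * Real.sign (xp j))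
        = lam j - A.transpose.mulVec (A.mulVec (z - w)) j
          - A.transpose.mulVec (A.mulVec w - b) j - β * (xp j - w j) + β * (z - w) j := by
      rw [hlam i hi j hj, hsplit, Pi.add_apply, Pi.sub_apply]
      ring
    rw [← hq, he, ← abs_of_pos hβ, ← abs_mul, ← abs_mul, abs_of_pos hβ]
    refine (abs_add_le _ _).trans (add_le_add_left ?_ _)
    refine (abs_sub _ _).trans (add_le_add_left ?_ _)
    refine (abs_sub _ _).trans (add_le_add_left ?_ _)
    exact abs_sub _ _
  have hsum := Finset.sum_le_sum hterm
  simp only [Finset.sum_add_distrib, ← Finset.mul_sum] at hsum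
  rw [← Finset.mul_sum] at hgrad
  have hlow : α * c ≤ α * c * (X ^ (1 - p) * ∑ j ∈ g i, |xp j| ^ (p - 1)) :=
    le_mul_of_one_le_right (mul_nonneg hα.le hc0) hgrad
  have b1 : ∑ j ∈ g i, |lam j| ≤ Real.sqrt n * (β * ε / 2 * D) := by
    refine (sum_abs_le_sqrt_mul_sqrt _ _).trans
      (mul_le_mul_of_nonneg_left ?_ (Real.sqrt_nonneg _))
    refine le_trans (Real.sqrt_le_sqrt ?_)
      (hlamb.trans (mul_le_mul_of_nonneg_left h1 (by positivity)))
    exact Finset.single_le_sum (f := fun i => ∑ j ∈ g i, lam j ^ 2)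
      (fun _ _ => Finset.sum_nonneg fun _ _ => sq_nonneg _) hi
  have b2 := sum_abs_le_of_sqrt_le (g i) _
    ((hNAtA (z - w)).trans (mul_le_mul_of_nonneg_left hzw hNAtA0))
  have b3 := sum_abs_le_of_sqrt_le (g i) _
    ((hNAT (A.mulVec w - b)).trans (mul_le_mul_of_nonneg_left h3 hNA0))
  have b4 := mul_le_mul_of_nonneg_left
    (sum_abs_le_of_sqrt_le (g i) (fun j => xp j - w j) h1) hβ.le
  have b5 := mul_le_mul_of_nonneg_left (sum_abs_le_of_sqrt_le (g i) (z - w) hzw) hβ.le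
  have hbound : α * c ≤ Real.sqrt n *
      ((NAtA + β * (4 + ε) / 2) * D + NA * Real.sqrt (2 * M)) := by
    linarith
  have hDeq : D = Real.sqrt 2 * Real.sqrt M / Real.sqrt (β * (1 - ε)) := by
    rw [hD, Real.sqrt_div (by positivity), Real.sqrt_mul (by norm_num)]
  have hB0 : 0 < Real.sqrt (β * (1 - ε)) := Real.sqrt_pos.mpr (by positivity)
  have h2pos : 0 < Real.sqrt 2 := Real.sqrt_pos.mpr (by norm_num)
  have hsq2 : Real.sqrt 2 * Real.sqrt 2 = 2 := Real.mul_self_sqrt (by norm_num)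
  rw [mul_assoc 2 β, Real.sqrt_mul (by norm_num : (0 : ℝ) ≤ 2) (β * (1 - ε)),
    le_div_iff₀ (by positivity)]
  rw [hDeq, Real.sqrt_mul (by norm_num : (0 : ℝ) ≤ 2) M] at hbound
  have hfin := mul_le_mul_of_nonneg_right hbound (mul_pos h2pos hB0).le
  set B := Real.sqrt (β * (1 - ε))
  set q := Real.sqrt 2
  calc c * (α * (q * B)) = α * c * (q * B) := by ring
    _ ≤ _ := hfin
    _ = Real.sqrt n * ((NAtA + β * (4 + ε) / 2) * (q * q) * Real.sqrt M
          + NA * (q * q) * Real.sqrt M * B) := by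
        field_simp
    _ = _ := by
        rw [hsq2]
        ring
end

section
/- (Relative error bound, Lemma 4.3, case p > 1.) Let p > 1, α > 0, β > 0, ε ∈ [0,1), t ∈ [0,1], and let ψ be differentiable on (0,∞). Let c > 0 and L ≥ 0 satisfy |ψ'(s) − ψ'(s')| ≤ L|s − s'| for all s, s' ≥ c, and let C > 0 satisfy ‖u‖_{p−1} ≤ C‖u‖_p for every subvector u ∈ ℝ^{g_i}, i = 1,…,r. Let v, w, x⁺ ∈ ℝ^n and S ⊆ {1,…,r} be such that v, w, x⁺ all vanish on every group outside S, and ‖w_{g_i}‖_p ≥ c and ‖x⁺_{g_i}‖_p ≥ c for every i ∈ S. Set z = w + t(w − v), and assume λ ∈ ℝ^n satisfies, for every i ∈ S and every j ∈ g_i, λ_j = (Aᵀ(Az − b))_j + β(x⁺ − z)_j + α ψ'(‖w_{g_i}‖_p)·‖x⁺_{g_i}‖_p^{1−p}·|x⁺_j|^{p−1}·sgn(x⁺_j), with (∑_{i∈S} ‖λ_{g_i}‖₂²)^{1/2} ≤ (βε/2)‖x⁺ − w‖₂. Define ν ∈ ℝ^n by ν_j = (Aᵀ(Ax⁺ − b))_j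 + α ψ'(‖x⁺_{g_i}‖_p)·‖x⁺_{g_i}‖_p^{1−p}·|x⁺_j|^{p−1}·sgn(x⁺_j) for j ∈ g_i with i ∈ S, and ν_j = 0 for all j belonging to groups outside S. Then ‖ν‖₂ ≤ Γ₁‖x⁺ − w‖₂ + Γ₂‖w − v‖₂, where Γ₁ = (‖AᵀA‖₂ + β + α·C^{p−1}·L + βε/2)·√n and Γ₂ = (‖AᵀA‖₂ + β)·√n. -/
/-- Minkowski's inequality for the Euclidean norm, in coordinates. -/
theorem sqrt_sum_sq_add_le {ι : Type*} (s : Finset ι) (f g : ι → ℝ) :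
    √(∑ i ∈ s, (f i + g i) ^ 2) ≤ √(∑ i ∈ s, f i ^ 2) + √(∑ i ∈ s, g i ^ 2) := by
  have h := Real.Lp_add_le s f g (p := 2) (by norm_num)
  simpa only [Real.sqrt_eq_rpow, Real.rpow_two, sq_abs] using h

theorem sqrt_sum_sq_const_mul {ι : Type*} (s : Finset ι) {a : ℝ} (ha : 0 ≤ a) (f : ι → ℝ) :
    √(∑ i ∈ s, (a * f i) ^ 2) = a * √(∑ i ∈ s, f i ^ 2) := by
  simp_rw [mul_pow, ← Finset.mul_sum]
  rw [Real.sqrt_mul (sq_nonneg a), Real.sqrt_sq ha]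

theorem sum_sq_le_sq_sum_abs {ι : Type*} (s : Finset ι) (f : ι → ℝ) :
    ∑ i ∈ s, f i ^ 2 ≤ (∑ i ∈ s, |f i|) ^ 2 := by
  rw [sq (∑ i ∈ s, |f i|), Finset.sum_mul]
  refine Finset.sum_le_sum fun i hi => ?_
  rw [← sq_abs, sq]
  exact mul_le_mul_of_nonneg_left
    (Finset.single_le_sum (f := fun i => |f i|) (fun _ _ => abs_nonneg _) hi) (abs_nonneg _)

theorem Lp_norm_le_sum_abs {ι : Type*} (s : Finset ι) (f : ι → ℝ) {p : ℝ} (hp : 1 ≤ p) :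
    (∑ i ∈ s, |f i| ^ p) ^ (1 / p) ≤ ∑ i ∈ s, |f i| := by
  have hp0 : 0 < p := by linarith
  have hM : 0 ≤ ∑ i ∈ s, |f i| := Finset.sum_nonneg fun _ _ => abs_nonneg _
  rw [one_div, Real.rpow_inv_le_iff_of_pos (by positivity) hM hp0]
  have hsplit : ∀ y : ℝ, 0 ≤ y → y ^ p = y * y ^ (p - 1) := fun y hy => by
    rw [← Real.rpow_one_add' hy (by linarith)]; ring_nf
  rw [hsplit _ hM, Finset.sum_mul]
  refine Finset.sum_le_sum fun i hi => ?_
  rw [hsplit _ (abs_nonneg _)]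
  refine mul_le_mul_of_nonneg_left (Real.rpow_le_rpow (abs_nonneg _) ?_ (by linarith))
    (abs_nonneg _)
  exact Finset.single_le_sum (f := fun i => |f i|) (fun _ _ => abs_nonneg _) hi

theorem Lp_norm_sub_le_sum_abs {ι : Type*} (s : Finset ι) (x y : ι → ℝ) {p : ℝ} (hp : 1 ≤ p) :
    (∑ i ∈ s, |x i| ^ p) ^ (1 / p) - (∑ i ∈ s, |y i| ^ p) ^ (1 / p) ≤ ∑ i ∈ s, |x i - y i| := by
  have h := Real.Lp_add_le s (fun i => x i - y i) y hp
  simp only [sub_add_cancel] at h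
  linarith [Lp_norm_le_sum_abs s (fun i => x i - y i) hp]

theorem abs_Lp_norm_sub_le_sum_abs {ι : Type*} (s : Finset ι) (x y : ι → ℝ) {p : ℝ}
    (hp : 1 ≤ p) :
    |(∑ i ∈ s, |x i| ^ p) ^ (1 / p) - (∑ i ∈ s, |y i| ^ p) ^ (1 / p)|
      ≤ ∑ i ∈ s, |x i - y i| := by
  refine abs_le.2 ⟨?_, Lp_norm_sub_le_sum_abs s x y hp⟩
  have h := Lp_norm_sub_le_sum_abs s y x hp
  simp_rw [abs_sub_comm (y _)] at h
  linarith

theorem Real.abs_sign_le_one (x : ℝ) : |Real.sign x| ≤ 1 := by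
  rcases Real.sign_apply_eq x with h | h | h <;> simp [h]

/-- The `ℓ₁` norm of the gradient of `‖·‖_p` at `x` is at most `C ^ (p - 1)` as soon as
`‖x‖_{p-1} ≤ C ‖x‖_p`. -/
theorem sum_abs_Lp_norm_gradient_le {ι : Type*} (s : Finset ι) (x : ι → ℝ) {p C X : ℝ}
    (hp : 1 < p) (hC : 0 ≤ C) (hX : 0 < X)
    (h : (∑ i ∈ s, |x i| ^ (p - 1)) ^ (1 / (p - 1)) ≤ C * X) :
    ∑ i ∈ s, |X ^ (1 - p) * |x i| ^ (p - 1) * Real.sign (x i)| ≤ C ^ (p - 1) := by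
  have hp1 : 0 < p - 1 := by linarith
  rw [one_div, Real.rpow_inv_le_iff_of_pos (by positivity) (by positivity) hp1,
    Real.mul_rpow hC hX.le] at h
  have hterm : ∀ i ∈ s, |X ^ (1 - p) * |x i| ^ (p - 1) * Real.sign (x i)|
      ≤ X ^ (1 - p) * |x i| ^ (p - 1) := fun i _ => by
    rw [abs_mul, abs_of_nonneg (by positivity)]
    exact mul_le_of_le_one_right (by positivity) (Real.abs_sign_le_one _)
  have hXX : X ^ (1 - p) * X ^ (p - 1) = 1 := by
    rw [← Real.rpow_add hX]; simp
  calc _ ≤ ∑ i ∈ s, X ^ (1 - p) * |x i| ^ (p - 1) := Finset.sum_le_sum hterm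
    _ = X ^ (1 - p) * ∑ i ∈ s, |x i| ^ (p - 1) := by rw [Finset.mul_sum]
    _ ≤ X ^ (1 - p) * (C ^ (p - 1) * X ^ (p - 1)) := by gcongr
    _ = C ^ (p - 1) * (X ^ (1 - p) * X ^ (p - 1)) := by ring
    _ = C ^ (p - 1) := by rw [hXX, mul_one]

theorem sum_sq_smul_Lp_norm_gradient_le {ι : Type*} (s : Finset ι) (x y : ι → ℝ)
    {p C X a K : ℝ} (hp : 1 < p) (hC : 0 ≤ C) (hX : 0 < X) (hK : 0 ≤ K)
    (h : (∑ i ∈ s, |x i| ^ (p - 1)) ^ (1 / (p - 1)) ≤ C * X)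
    (ha : |a| ≤ K * ∑ i ∈ s, |x i - y i|) :
    ∑ i ∈ s, (a * (X ^ (1 - p) * |x i| ^ (p - 1) * Real.sign (x i))) ^ 2
      ≤ (K * C ^ (p - 1)) ^ 2 * (s.card * ∑ i ∈ s, (x i - y i) ^ 2) := by
  have hgrad := sum_abs_Lp_norm_gradient_le s x hp hC hX h
  have hcs := sq_sum_le_card_mul_sum_sq (s := s) (f := fun i => |x i - y i|)
  simp only [sq_abs] at hcs
  refine (sum_sq_le_sq_sum_abs s _).trans ?_
  calc _ = (|a| * ∑ i ∈ s, |X ^ (1 - p) * |x i| ^ (p - 1) * Real.sign (x i)|) ^ 2 := by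
        simp_rw [abs_mul a, Finset.mul_sum]
    _ ≤ ((K * ∑ i ∈ s, |x i - y i|) * C ^ (p - 1)) ^ 2 := by gcongr
    _ = (K * C ^ (p - 1)) ^ 2 * (∑ i ∈ s, |x i - y i|) ^ 2 := by ring
    _ ≤ _ := by gcongr


/-- Relative error bound (Lemma 4.3, case `p > 1`).  With `ψ'` `L`-Lipschitz on
`[c,∞)`, a constant `C > 0` with `‖u‖_{p-1} ≤ C‖u‖_p` for all group subvectors,
`v, w, x⁺` supported in `S` with `‖w_{gᵢ}‖_p ≥ c` and `‖x⁺_{gᵢ}‖_p ≥ c` on `S`,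
`z = w + t(w - v)`, the certificate `λ` satisfying the stated formula on groups
in `S` with `‖λ_S‖₂ ≤ (βε/2)‖x⁺ - w‖₂`, `NAtA` a spectral bound for `AᵀA`, and
`ν` the subgradient candidate at `x⁺`: then
`‖ν‖₂ ≤ Γ₁‖x⁺ - w‖₂ + Γ₂‖w - v‖₂` with
`Γ₁ = (NAtA + β + αC^{p-1}L + βε/2)√n` and `Γ₂ = (NAtA + β)√n`. -/
theorem stmt_19 (m n r : ℕ) (hm : 1 ≤ m) (hn : 1 ≤ n) (hr : 1 ≤ r)
    (g : Fin r → Finset (Fin n))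
    (hne : ∀ i, (g i).Nonempty)
    (hdisj : ∀ i i', i ≠ i' → Disjoint (g i) (g i'))
    (hcover : ∀ j, ∃ i, j ∈ g i)
    (A : Matrix (Fin m) (Fin n) ℝ) (b : Fin m → ℝ)
    (p α β ε t : ℝ) (hp : 1 < p) (hα : 0 < α) (hβ : 0 < β)
    (hε0 : 0 ≤ ε) (hε1 : ε < 1) (ht0 : 0 ≤ t) (ht1 : t ≤ 1)
    (ψ ψ' : ℝ → ℝ)
    (hd1 : ∀ s ∈ Set.Ioi (0:ℝ), HasDerivAt ψ (ψ' s) s)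
    (c L : ℝ) (hc : 0 < c) (hL : 0 ≤ L)
    (hLip : ∀ s s' : ℝ, c ≤ s → c ≤ s' → |ψ' s - ψ' s'| ≤ L * |s - s'|)
    (C : ℝ) (hC : 0 < C)
    (hCnorm : ∀ i : Fin r, ∀ u : Fin n → ℝ,
      (∑ j ∈ g i, |u j| ^ (p - 1)) ^ (1 / (p - 1))
        ≤ C * (∑ j ∈ g i, |u j| ^ p) ^ (1 / p))
    (v w xp : Fin n → ℝ) (S : Finset (Fin r))
    (hv0 : ∀ i ∉ S, ∀ j ∈ g i, v j = 0)
    (hw0 : ∀ i ∉ S, ∀ j ∈ g i, w j = 0)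
    (hxp0 : ∀ i ∉ S, ∀ j ∈ g i, xp j = 0)
    (hwS : ∀ i ∈ S, c ≤ (∑ j ∈ g i, |w j| ^ p) ^ (1 / p))
    (hxpS : ∀ i ∈ S, c ≤ (∑ j ∈ g i, |xp j| ^ p) ^ (1 / p))
    (z : Fin n → ℝ) (hz : ∀ j, z j = w j + t * (w j - v j))
    (lam : Fin n → ℝ)
    (hlam : ∀ i ∈ S, ∀ j ∈ g i, lam j =
        A.transpose.mulVec (A.mulVec z - b) j + β * (xp j - z j)
        + α * ψ' ((∑ j' ∈ g i, |w j'| ^ p) ^ (1 / p))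
            * ((∑ j' ∈ g i, |xp j'| ^ p) ^ (1 / p)) ^ (1 - p)
            * |xp j| ^ (p - 1) * Real.sign (xp j))
    (hlamb : Real.sqrt (∑ i ∈ S, ∑ j ∈ g i, (lam j) ^ 2)
        ≤ β * ε / 2 * Real.sqrt (∑ j, (xp j - w j) ^ 2))
    (NAtA : ℝ)
    (hNAtA : ∀ u : Fin n → ℝ,
      Real.sqrt (∑ j, (A.transpose.mulVec (A.mulVec u) j) ^ 2)
        ≤ NAtA * Real.sqrt (∑ j, (u j) ^ 2))
    (ν : Fin n → ℝ)
    (hν1 : ∀ i ∈ S, ∀ j ∈ g i, ν j =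
        A.transpose.mulVec (A.mulVec xp - b) j
        + α * ψ' ((∑ j' ∈ g i, |xp j'| ^ p) ^ (1 / p))
            * ((∑ j' ∈ g i, |xp j'| ^ p) ^ (1 / p)) ^ (1 - p)
            * |xp j| ^ (p - 1) * Real.sign (xp j))
    (hν0 : ∀ i ∉ S, ∀ j ∈ g i, ν j = 0) :
    Real.sqrt (∑ j, (ν j) ^ 2)
      ≤ (NAtA + β + α * C ^ (p - 1) * L + β * ε / 2) * Real.sqrt n
          * Real.sqrt (∑ j, (xp j - w j) ^ 2)
        + (NAtA + β) * Real.sqrt n * Real.sqrt (∑ j, (w j - v j) ^ 2) := by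
  choose ι hι using hcover
  have hmem : ∀ i j, j ∈ g i ↔ ι j = i := fun i j => by
    refine ⟨fun hj => ?_, fun h => h ▸ hι j⟩
    by_contra hne'
    exact Finset.disjoint_left.1 (hdisj _ _ hne') (hι j) hj
  have hfib : ∀ f : Fin n → ℝ, ∑ j, f j = ∑ i, ∑ j ∈ g i, f j := fun f => by
    have hg : ∀ i, g i = Finset.univ.filter fun j => ι j = i := fun i => by
      ext j; simp [hmem]
    simp_rw [hg]
    exact (Finset.sum_fiberwise _ _ _).symm
  have hN : 0 ≤ NAtA := by
    have h := (Real.sqrt_nonneg _).trans (hNAtA fun _ => 1)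
    have hn' : 0 < √(∑ _j : Fin n, (1 : ℝ) ^ 2) := by
      have : (0 : ℝ) < n := by exact_mod_cast hn
      simpa using this
    exact nonneg_of_mul_nonneg_left h hn'
  set X : Fin r → ℝ := fun i => (∑ j ∈ g i, |xp j| ^ p) ^ (1 / p)
  set W : Fin r → ℝ := fun i => (∑ j ∈ g i, |w j| ^ p) ^ (1 / p)
  set dx := √(∑ j, (xp j - w j) ^ 2) with hdx
  set dw := √(∑ j, (w j - v j) ^ 2)
  let lamS : Fin n → ℝ := fun j => if ι j ∈ S then lam j else 0
  let G : Fin n → ℝ := fun j => if ι j ∈ S then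
    α * (ψ' (X (ι j)) - ψ' (W (ι j)))
      * (X (ι j) ^ (1 - p) * |xp j| ^ (p - 1) * Real.sign (xp j)) else 0
  have hlamS : √(∑ j, lamS j ^ 2) ≤ β * ε / 2 * dx := by
    refine le_of_eq_of_le (congrArg _ ?_) hlamb
    rw [hfib, ← Finset.sum_subset (Finset.subset_univ S)]
    · refine Finset.sum_congr rfl fun i hi => Finset.sum_congr rfl fun j hj => ?_
      simp [lamS, (hmem i j).1 hj, hi]
    · refine fun i _ hi => Finset.sum_eq_zero fun j hj => ?_
      simp [lamS, (hmem i j).1 hj, hi]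
  have hG : √(∑ j, G j ^ 2) ≤ α * L * C ^ (p - 1) * (√n * dx) := by
    rw [hdx, ← Real.sqrt_mul (Nat.cast_nonneg n), ← Real.sqrt_sq (x := α * L * C ^ (p - 1))
      (by positivity), ← Real.sqrt_mul (sq_nonneg _)]
    refine Real.sqrt_le_sqrt ?_
    rw [hfib, hfib, Finset.mul_sum, Finset.mul_sum]
    refine Finset.sum_le_sum fun i _ => ?_
    by_cases hi : i ∈ S
    · have ha : |α * (ψ' (X i) - ψ' (W i))| ≤ α * L * ∑ j ∈ g i, |xp j - w j| := by
        rw [abs_mul, abs_of_pos hα, mul_assoc]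
        gcongr
        refine (hLip _ _ (hxpS i hi) (hwS i hi)).trans ?_
        gcongr
        exact abs_Lp_norm_sub_le_sum_abs _ _ _ hp.le
      have hcard : ((g i).card : ℝ) ≤ n := by
        exact_mod_cast (Finset.card_le_univ (g i)).trans_eq (Fintype.card_fin n)
      have h := sum_sq_smul_Lp_norm_gradient_le (g i) xp w hp hC.le
        (hc.trans_le (hxpS i hi)) (by positivity) (hCnorm i xp) ha
      refine le_of_eq_of_le (Finset.sum_congr rfl fun j hj => ?_) (h.trans ?_)
      · simp [G, (hmem i j).1 hj, hi, X]
      · have : 0 ≤ ∑ j ∈ g i, (xp j - w j) ^ 2 := Finset.sum_nonneg fun _ _ => sq_nonneg _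
        gcongr
    · rw [Finset.sum_eq_zero fun j hj => by simp [G, (hmem i j).1 hj, hi]]
      have : 0 ≤ ∑ j ∈ g i, (xp j - w j) ^ 2 := Finset.sum_nonneg fun _ _ => sq_nonneg _
      positivity
  let Q : Fin n → ℝ := fun j => A.transpose.mulVec (A.mulVec (xp - z)) j
  have hQ : ∀ j, Q j = A.transpose.mulVec (A.mulVec xp - b) j
      - A.transpose.mulVec (A.mulVec z - b) j := fun j => by
    simp only [Q, Matrix.mulVec_sub, Pi.sub_apply]; ring
  have hdz : √(∑ j, (z j - xp j) ^ 2) ≤ dx + dw := by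
    have h := sqrt_sum_sq_add_le Finset.univ (fun j => w j - xp j) (fun j => t * (w j - v j))
    rw [sqrt_sum_sq_const_mul _ ht0] at h
    have e1 : ∀ j, w j - xp j + t * (w j - v j) = z j - xp j := fun j => by rw [hz]; ring
    simp only [e1, sub_sq_comm (w _) (xp _)] at h
    have : t * dw ≤ dw := mul_le_of_le_one_left (Real.sqrt_nonneg _) ht1
    linarith
  have hQn : √(∑ j, Q j ^ 2) ≤ NAtA * (dx + dw) := by
    refine (hNAtA (xp - z)).trans (mul_le_mul_of_nonneg_left ?_ hN)
    simpa only [Pi.sub_apply, sub_sq_comm (xp _) (z _)] using hdz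
  have hνle : √(∑ j, ν j ^ 2)
      ≤ √(∑ j, ((lamS j + G j) + (Q j + β * (z j - xp j))) ^ 2) := by
    refine Real.sqrt_le_sqrt (Finset.sum_le_sum fun j _ => ?_)
    by_cases hj : ι j ∈ S
    · refine le_of_eq (congrArg (· ^ 2) ?_)
      rw [hQ, hν1 _ hj j (hι j)]
      simp only [lamS, G, if_pos hj, X, W]
      rw [hlam _ hj j (hι j)]
      ring
    · rw [hν0 _ hj j (hι j)]
      simpa using sq_nonneg _
  have h1 := sqrt_sum_sq_add_le Finset.univ (fun j => lamS j + G j)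
    (fun j => Q j + β * (z j - xp j))
  have h2 := sqrt_sum_sq_add_le Finset.univ lamS G
  have h3 := sqrt_sum_sq_add_le Finset.univ Q (fun j => β * (z j - xp j))
  rw [sqrt_sum_sq_const_mul _ hβ.le] at h3
  have h4 := mul_le_mul_of_nonneg_left hdz hβ.le
  have hs : 1 ≤ √(n : ℝ) := Real.one_le_sqrt.2 (by exact_mod_cast hn)
  have hdx0 : 0 ≤ dx := Real.sqrt_nonneg _
  have hdw0 : 0 ≤ dw := Real.sqrt_nonneg _
  have h5 : (NAtA + β + β * ε / 2) * dx * 1 ≤ (NAtA + β + β * ε / 2) * dx * √n := by gcongr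
  have h6 : (NAtA + β) * dw * 1 ≤ (NAtA + β) * dw * √n := by gcongr
  linarith
end
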